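/- Over a uniformly random permutation π, the expected number of disagreements induced by the pivot clusters of sequential Truncated-Pivot satisfies E[C^pivot] ≤ 3·OPT. -/

import Mathlib

open scoped Classical

namespace TruncatedPivot

/-- Status of a node during the run of (sequential) Truncated-Pivot. -/
inductive Status (N : ℕ) where
  | active : Status N
  | singleton : Status N
  | clustered : Fin N → Status N
  deriving DecidableEq

variable {N : ℕ}

/-- Degree of `u`: number of positive edges incident on `u`. -/
def deg (adj : Fin N → Fin N → Bool) (u : Fin N) : ℕ :=
  (Finset.univ.filter fun v => adj u v = true).card

/-- Number of disagreements of the clustering whose parts are the fibers of `f`: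
positive pairs split between two parts plus negative pairs inside one part. -/
def cost (adj : Fin N → Fin N → Bool) (f : Fin N → Fin N) : ℕ :=
  (Finset.univ.filter fun p : Fin N × Fin N =>
    p.1 < p.2 ∧ ((adj p.1 p.2 = true ∧ f p.1 ≠ f p.2) ∨
      (adj p.1 p.2 = false ∧ f p.1 = f p.2))).card

/-- Minimum number of disagreements over all clusterings (every partition of `Fin N`
arises as the fibers of some `f : Fin N → Fin N`). -/
noncomputable def OPT (adj : Fin N → Fin N → Bool) : ℕ :=
  sInf (Set.range (cost adj))

/-- The singleton-creating sub-step of iteration `i` of sequential Truncated-Pivot: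
every active node `v` with `deg v ≥ (c/ε)·(N·log N)/i` (equivalently
`deg v · i ≥ (c/ε)·(N·log N)`, as `i ≥ 1`) becomes a singleton cluster. -/
noncomputable def singStep (adj : Fin N → Fin N → Bool) (c ε : ℝ) (i : ℕ)
    (s : Fin N → Status N) : Fin N → Status N := fun v =>
  if s v = Status.active ∧ (c / ε) * ((N : ℝ) * Real.log N) ≤ (deg adj v : ℝ) * (i : ℝ) then
    Status.singleton
  else s v

/-- The pivot sub-step: if `u` is still active, it forms a pivot cluster together with all
of its currently active positive neighbors. -/
def pivStep (adj : Fin N → Fin N → Bool) (u : Fin N) (s : Fin N → Status N) :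
    Fin N → Status N := fun v =>
  if s u = Status.active ∧ s v = Status.active ∧ (v = u ∨ adj u v = true) then
    Status.clustered u
  else s v

/-- `seqStates adj c ε π k` is the status of every node after the first `k` iterations of
sequential Truncated-Pivot run with permutation `π` (iteration `i = k+1` processes the
node at position `i`, i.e. `π.symm ⟨k⟩`). -/
noncomputable def seqStates (adj : Fin N → Fin N → Bool) (c ε : ℝ) (π : Equiv.Perm (Fin N)) :
    ℕ → Fin N → Status N
  | 0 => fun _ => Status.active
  | k + 1 =>
    if h : k < N then
      pivStep adj (π.symm ⟨k, h⟩) (singStep adj c ε (k + 1) (seqStates adj c ε π k))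
    else seqStates adj c ε π k

/-- The cluster label (representative) of each node in the clustering output by
sequential Truncated-Pivot: members of the pivot cluster of pivot `p` get label `p`,
singleton clusters get the node itself. -/
noncomputable def seqLabel (adj : Fin N → Fin N → Bool) (c ε : ℝ) (π : Equiv.Perm (Fin N))
    (v : Fin N) : Fin N :=
  match seqStates adj c ε π N v with
  | Status.clustered p => p
  | _ => v

/-- The state in iteration `k+1` just after the singleton sub-step and right before the
pivot sub-step. -/
noncomputable def midState (adj : Fin N → Fin N → Bool) (c ε : ℝ) (π : Equiv.Perm (Fin N))
    (k : ℕ) : Fin N → Status N :=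
  singStep adj c ε (k + 1) (seqStates adj c ε π k)

/-- Membership in the (potential) pivot cluster of pivot `p`. -/
def inPivCluster (adj : Fin N → Fin N → Bool) (p v : Fin N) : Prop :=
  v = p ∨ adj p v = true

/-- The (positive) edge `{a,b}` is cut by the pivot cluster created at iteration `k+1`:
the pivot and both endpoints are active when the cluster is created, and exactly one of
`a`, `b` is included in the cluster. -/
def cutAt (adj : Fin N → Fin N → Bool) (c ε : ℝ) (π : Equiv.Perm (Fin N)) (k : Fin N)
    (a b : Fin N) : Prop :=
  midState adj c ε π k.val (π.symm k) = Status.active ∧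
  midState adj c ε π k.val a = Status.active ∧
  midState adj c ε π k.val b = Status.active ∧
  ((inPivCluster adj (π.symm k) a ∧ ¬ inPivCluster adj (π.symm k) b) ∨
    (inPivCluster adj (π.symm k) b ∧ ¬ inPivCluster adj (π.symm k) a))

/-- `C^pivot`: the number of disagreements induced by the pivot clusters of sequential
Truncated-Pivot: negative pairs inside a common pivot cluster, plus positive edges cut
by a pivot cluster at the iteration it was created. -/
noncomputable def Cpivot (adj : Fin N → Fin N → Bool) (c ε : ℝ) (π : Equiv.Perm (Fin N)) : ℕ :=
  (Finset.univ.filter fun p : Fin N × Fin N =>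
    p.1 < p.2 ∧
      ((adj p.1 p.2 = true ∧ ∃ k : Fin N, cutAt adj c ε π k p.1 p.2) ∨
        (adj p.1 p.2 = false ∧ ∃ q : Fin N,
          seqStates adj c ε π N p.1 = Status.clustered q ∧
          seqStates adj c ε π N p.2 = Status.clustered q))).card

/-- A bad triangle: three distinct vertices with exactly two positive edges. -/
def IsBadTriangle (adj : Fin N → Fin N → Bool) (t : Finset (Fin N)) : Prop :=
  ∃ u v w : Fin N, t = {u, v, w} ∧ u ≠ v ∧ v ≠ w ∧ u ≠ w ∧
    adj u v = true ∧ adj v w = true ∧ adj u w = false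

/-- The set `T` of all bad triangles. -/
noncomputable def badTriangles (adj : Fin N → Fin N → Bool) : Finset (Finset (Fin N)) :=
  Finset.univ.filter (IsBadTriangle adj)

/-- The event `A_t`: at some iteration of sequential Truncated-Pivot all three nodes of the
bad triangle `t` are active and one of them is the node of that iteration (hence it
creates a pivot cluster). -/
def eventA (adj : Fin N → Fin N → Bool) (c ε : ℝ) (t : Finset (Fin N))
    (π : Equiv.Perm (Fin N)) : Prop :=
  ∃ k : Fin N, π.symm k ∈ t ∧ ∀ x ∈ t, midState adj c ε π k.val x = Status.active

/-- `N_i(u)`: positive neighbors `v` of `u` with `deg v ≤ deg u` that have not joined a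
pivot cluster before iteration `i` (i.e. in the state at the beginning of iteration `i`). -/
noncomputable def NdegI (adj : Fin N → Fin N → Bool) (c ε : ℝ) (π : Equiv.Perm (Fin N))
    (i : ℕ) (u : Fin N) : Finset (Fin N) :=
  Finset.univ.filter fun v => adj u v = true ∧ deg adj v ≤ deg adj u ∧
    ∀ p : Fin N, seqStates adj c ε π (i - 1) v ≠ Status.clustered p

/-- `u` is placed into a singleton cluster at iteration `i` (`1 ≤ i ≤ N`). -/
def becomesSingletonAt (adj : Fin N → Fin N → Bool) (c ε : ℝ) (π : Equiv.Perm (Fin N))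
    (u : Fin N) (i : ℕ) : Prop :=
  1 ≤ i ∧ i ≤ N ∧ seqStates adj c ε π (i - 1) u = Status.active ∧
    seqStates adj c ε π i u = Status.singleton

/-- `E^sin`: positive edges with at least one endpoint in a singleton cluster. -/
noncomputable def Esin (adj : Fin N → Fin N → Bool) (c ε : ℝ) (π : Equiv.Perm (Fin N)) :
    Finset (Fin N × Fin N) :=
  Finset.univ.filter fun p => p.1 < p.2 ∧ adj p.1 p.2 = true ∧
    (seqStates adj c ε π N p.1 = Status.singleton ∨
      seqStates adj c ε π N p.2 = Status.singleton)

/-- A good edge of `E^sin`: one endpoint is placed into a singleton cluster at some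
iteration `i` and the other endpoint had joined a pivot cluster at some iteration `j < i`. -/
def goodPair (adj : Fin N → Fin N → Bool) (c ε : ℝ) (π : Equiv.Perm (Fin N))
    (a b : Fin N) : Prop :=
  (∃ i : ℕ, becomesSingletonAt adj c ε π a i ∧
    ∃ p : Fin N, seqStates adj c ε π (i - 1) b = Status.clustered p) ∨
  (∃ i : ℕ, becomesSingletonAt adj c ε π b i ∧
    ∃ p : Fin N, seqStates adj c ε π (i - 1) a = Status.clustered p)

/-- `E^bad`: the edges of `E^sin` that are not good. -/
noncomputable def Ebad (adj : Fin N → Fin N → Bool) (c ε : ℝ) (π : Equiv.Perm (Fin N)) :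
    Finset (Fin N × Fin N) :=
  (Esin adj c ε π).filter fun p => ¬ goodPair adj c ε π p.1 p.2

/-- A node `u` is interesting for permutation `π` iff `π_u < τ_u`, i.e.
`π_u · deg u < (c/ε)·(N·log N)` where `π_u ∈ {1,…,N}` is the position of `u`. -/
def interesting (adj : Fin N → Fin N → Bool) (c ε : ℝ) (π : Equiv.Perm (Fin N))
    (u : Fin N) : Prop :=
  (((π u).val : ℝ) + 1) * (deg adj u : ℝ) < (c / ε) * ((N : ℝ) * Real.log N)

/-- The greedy maximal independent set of `G_store` (the subgraph induced by the
interesting nodes) along `π`: nodes are processed in increasing order of position and a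
node joins iff it is interesting and has no earlier neighbor already in the set. -/
noncomputable def pivots (adj : Fin N → Fin N → Bool) (c ε : ℝ) (π : Equiv.Perm (Fin N)) :
    Finset (Fin N) :=
  (List.finRange N).foldl
    (fun I j =>
      if interesting adj c ε π (π.symm j) ∧ ∀ v ∈ I, adj (π.symm j) v = false then
        insert (π.symm j) I
      else I) ∅

/-- The cluster label of each node in the clustering output by parallel Truncated-Pivot:
pivots are their own label; a non-pivot `u` joins its pivot positive neighbor `v` of
smallest position provided `π_v < τ_u`; all remaining nodes form singleton clusters. -/
noncomputable def parLabel (adj : Fin N → Fin N → Bool) (c ε : ℝ) (π : Equiv.Perm (Fin N))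
    (u : Fin N) : Fin N :=
  if u ∈ pivots adj c ε π then u
  else
    let S := (pivots adj c ε π).filter fun v => adj u v = true ∧
      (((π v).val : ℝ) + 1) * (deg adj u : ℝ) < (c / ε) * ((N : ℝ) * Real.log N)
    if h : S.Nonempty then π.symm ((S.image fun v => π v).min' (h.image _)) else u

/-- The number of positive edges with at least one interesting endpoint (i.e. with at
least one endpoint in `G_store`). -/
noncomputable def interEdges (adj : Fin N → Fin N → Bool) (c ε : ℝ)
    (π : Equiv.Perm (Fin N)) : Finset (Fin N × Fin N) :=
  Finset.univ.filter fun p => p.1 < p.2 ∧ adj p.1 p.2 = true ∧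
    (interesting adj c ε π p.1 ∨ interesting adj c ε π p.2)

/-- Probability of an event over a uniformly random permutation of `Fin N`. -/
noncomputable def Pr (N : ℕ) (P : Equiv.Perm (Fin N) → Prop) : ℝ :=
  ((Finset.univ.filter P).card : ℝ) / (Nat.factorial N : ℝ)

/-- Expectation of a real random variable over a uniformly random permutation of `Fin N`. -/
noncomputable def Ex (N : ℕ) (X : Equiv.Perm (Fin N) → ℝ) : ℝ :=
  (∑ π : Equiv.Perm (Fin N), X π) / (Nat.factorial N : ℝ)



section Runs

variable {adj : Fin N → Fin N → Bool} {c ε : ℝ} {π : Equiv.Perm (Fin N)}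

lemma seqStates_succ (k : Fin N) :
    seqStates adj c ε π (k + 1) = pivStep adj (π.symm k) (midState adj c ε π k) := by
  simp [seqStates, midState]

lemma active_of_midState_active {k : ℕ} {v : Fin N}
    (h : midState adj c ε π k v = Status.active) :
    seqStates adj c ε π k v = Status.active := by
  unfold midState singStep at h
  split_ifs at h with h1
  exact h

lemma midState_active_of_succ {k : Fin N} {v : Fin N}
    (h : seqStates adj c ε π (k + 1) v = Status.active) :
    midState adj c ε π k v = Status.active := by
  rw [seqStates_succ] at h
  unfold pivStep at h
  split_ifs at h with h1
  exact h

lemma seqStates_active_of_le {j k : ℕ} (hjk : j ≤ k) {v : Fin N}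
    (h : seqStates adj c ε π k v = Status.active) :
    seqStates adj c ε π j v = Status.active := by
  induction k, hjk using Nat.le_induction with
  | base => exact h
  | succ k _ ih =>
    apply ih
    by_cases hk : k < N
    · exact active_of_midState_active (midState_active_of_succ (k := ⟨k, hk⟩) h)
    · simpa [seqStates, hk] using h

/-- No member of the pivot cluster of an active pivot stays active. -/
lemma not_active_of_inPivCluster {j : Fin N} {k : ℕ} (hjk : (j : ℕ) < k) {v : Fin N}
    (hp : midState adj c ε π j (π.symm j) = Status.active)
    (hv : inPivCluster adj (π.symm j) v) :
    midState adj c ε π k v ≠ Status.active := by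
  intro h
  have h1 := seqStates_active_of_le (Nat.succ_le_of_lt hjk) (active_of_midState_active h)
  have h2 := midState_active_of_succ h1
  rw [Nat.succ_eq_add_one, seqStates_succ] at h1
  unfold pivStep at h1
  rw [if_pos ⟨hp, h2, hv⟩] at h1
  cases h1

/-- A node that is still active has not been processed yet. -/
lemma le_of_midState_active {k : ℕ} {v : Fin N}
    (h : midState adj c ε π k v = Status.active) : k ≤ π v := by
  by_contra! hlt
  have h1 := midState_active_of_succ
    (seqStates_active_of_le (Nat.succ_le_of_lt hlt) (active_of_midState_active h))
  exact not_active_of_inPivCluster hlt (by simpa using h1) (Or.inl (by simp)) h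

lemma seqStates_congr {π' : Equiv.Perm (Fin N)} (k : ℕ)
    (h : ∀ j : Fin N, (j : ℕ) < k → π.symm j = π'.symm j) :
    seqStates adj c ε π k = seqStates adj c ε π' k := by
  induction k with
  | zero => rfl
  | succ k ih =>
    have ih' := ih fun j hj => h j (by omega)
    by_cases hk : k < N
    · simp only [seqStates, hk, dif_pos, ih', h ⟨k, hk⟩ (Nat.lt_succ_self k)]
    · simp only [seqStates, hk, dif_neg, not_false_eq_true, ih']

lemma midState_congr {π' : Equiv.Perm (Fin N)} (k : ℕ)
    (h : ∀ j : Fin N, (j : ℕ) < k → π.symm j = π'.symm j) :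
    midState adj c ε π k = midState adj c ε π' k := by
  unfold midState
  rw [seqStates_congr k h]

lemma active_of_clustered {n : ℕ} {v q : Fin N}
    (h : seqStates adj c ε π n v = Status.clustered q) :
    midState adj c ε π (π q) q = Status.active ∧
      midState adj c ε π (π q) v = Status.active ∧ inPivCluster adj q v := by
  induction n with
  | zero => cases h
  | succ n ih =>
    by_cases hn : n < N
    · have h' : seqStates adj c ε π ((⟨n, hn⟩ : Fin N) + 1) v = Status.clustered q := h
      rw [seqStates_succ] at h'
      unfold pivStep at h'
      split_ifs at h' with h1
      · cases h'
        simpa [inPivCluster] using h1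
      · apply ih
        unfold midState singStep at h'
        split_ifs at h' with h2
        exact h'
    · exact ih (by simpa [seqStates, hn] using h)

end Runs

/-- An ordered bad triangle: three distinct vertices with exactly one negative pair. -/
def OrderedBad (adj : Fin N → Fin N → Bool) (a b w : Fin N) : Prop :=
  a ≠ b ∧ b ≠ w ∧ a ≠ w ∧
    ((adj a b = true ∧ adj b w = true ∧ adj a w = false) ∨
      (adj a b = true ∧ adj b w = false ∧ adj a w = true) ∨
      (adj a b = false ∧ adj b w = true ∧ adj a w = true))

/-- `w` is processed while `a`, `b` and `w` are all active, and they form a bad triangle. -/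
def PivotHits (adj : Fin N → Fin N → Bool) (c ε : ℝ) (π : Equiv.Perm (Fin N))
    (a b w : Fin N) : Prop :=
  OrderedBad adj a b w ∧ midState adj c ε π (π w) a = Status.active ∧
    midState adj c ε π (π w) b = Status.active ∧ midState adj c ε π (π w) w = Status.active

/-- The number of permutations for which the pivot `w` hits the bad triangle `a`, `b`, `w`. -/
noncomputable def hitCount (adj : Fin N → Fin N → Bool) (c ε : ℝ) (a b w : Fin N) : ℕ :=
  (Finset.univ.filter fun π => PivotHits adj c ε π a b w).card

/-- The pair `a`, `b` is a disagreement of the clustering given by the fibers of `f`. -/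
def Disagrees (adj : Fin N → Fin N → Bool) (f : Fin N → Fin N) (a b : Fin N) : Prop :=
  (adj a b = true ∧ f a ≠ f b) ∨ (adj a b = false ∧ f a = f b)

lemma two_mul_card_filter_lt (P : Fin N → Fin N → Prop) (hP : ∀ a b, P a b → P b a) :
    2 * (Finset.univ.filter fun p : Fin N × Fin N => p.1 < p.2 ∧ P p.1 p.2).card =
      (Finset.univ.filter fun p : Fin N × Fin N => p.1 ≠ p.2 ∧ P p.1 p.2).card := by
  have h1 : (Finset.univ.filter fun p : Fin N × Fin N => p.1 < p.2 ∧ P p.1 p.2).card =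
      (Finset.univ.filter fun p : Fin N × Fin N => p.2 < p.1 ∧ P p.1 p.2).card := by
    apply Finset.card_bij (fun p _ => p.swap)
    · intro p hp
      simp only [Finset.mem_filter, Finset.mem_univ, true_and, Prod.fst_swap,
        Prod.snd_swap] at hp ⊢
      exact ⟨hp.1, hP _ _ hp.2⟩
    · intro p _ q _ h
      exact Prod.swap_injective h
    · intro p hp
      simp only [Finset.mem_filter, Finset.mem_univ, true_and] at hp
      exact ⟨p.swap, by simpa using ⟨hp.1, hP _ _ hp.2⟩, by simp⟩
  have h2 : (Finset.univ.filter fun p : Fin N × Fin N => p.1 ≠ p.2 ∧ P p.1 p.2) =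
      (Finset.univ.filter fun p : Fin N × Fin N => p.1 < p.2 ∧ P p.1 p.2) ∪
      (Finset.univ.filter fun p : Fin N × Fin N => p.2 < p.1 ∧ P p.1 p.2) := by
    ext p
    simp only [Finset.mem_filter, Finset.mem_univ, true_and, Finset.mem_union, ne_iff_lt_or_gt,
      or_and_right]
  rw [h2, Finset.card_union_of_disjoint, ← h1, two_mul]
  rw [Finset.disjoint_left]
  intro p hp hq
  simp only [Finset.mem_filter, Finset.mem_univ, true_and] at hp hq
  exact lt_asymm hp.1 hq.1

section Charging

variable {adj : Fin N → Fin N → Bool} {c ε : ℝ}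

lemma OrderedBad.swap_left (hsymm : ∀ u v, adj u v = adj v u) {a b w : Fin N}
    (h : OrderedBad adj a b w) : OrderedBad adj b a w := by
  have := hsymm a b
  unfold OrderedBad at *
  grind

lemma OrderedBad.swap_outer (hsymm : ∀ u v, adj u v = adj v u) {a b w : Fin N}
    (h : OrderedBad adj a b w) : OrderedBad adj w b a := by
  have := hsymm a b
  have := hsymm b w
  have := hsymm a w
  unfold OrderedBad at *
  grind

lemma PivotHits.swap_left (hsymm : ∀ u v, adj u v = adj v u) {π : Equiv.Perm (Fin N)}
    {a b w : Fin N} (h : PivotHits adj c ε π a b w) : PivotHits adj c ε π b a w :=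
  ⟨h.1.swap_left hsymm, h.2.2.1, h.2.1, h.2.2.2⟩

/-- Exchanging the positions of `a` and `w` exchanges their roles as pivots. -/
lemma PivotHits.swap_outer (hsymm : ∀ u v, adj u v = adj v u) {π : Equiv.Perm (Fin N)}
    {a b w : Fin N} (h : PivotHits adj c ε π a b w) :
    PivotHits adj c ε ((Equiv.swap a w).trans π) w b a := by
  obtain ⟨hbad, ha, hb, hw⟩ := h
  have hpos := le_of_midState_active ha
  have hmid : midState adj c ε π (π w) =
      midState adj c ε ((Equiv.swap a w).trans π) (π w) := by
    apply midState_congr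
    intro j hj
    rw [Equiv.symm_trans_apply, Equiv.symm_swap, Equiv.swap_apply_of_ne_of_ne]
    · rintro rfl
      simp only [Equiv.apply_symm_apply] at hpos
      omega
    · rintro rfl
      simp at hj
  have hk : ((Equiv.swap a w).trans π) a = π w := by simp
  rw [PivotHits, hk, ← hmid]
  exact ⟨hbad.swap_outer hsymm, hw, hb, ha⟩

lemma hitCount_swap_left (hsymm : ∀ u v, adj u v = adj v u) (a b w : Fin N) :
    hitCount adj c ε a b w = hitCount adj c ε b a w := by
  unfold hitCount
  congr 1
  ext π
  simp only [Finset.mem_filter, Finset.mem_univ, true_and]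
  exact ⟨fun h => h.swap_left hsymm, fun h => h.swap_left hsymm⟩

lemma hitCount_le_swap_outer (hsymm : ∀ u v, adj u v = adj v u) (a b w : Fin N) :
    hitCount adj c ε a b w ≤ hitCount adj c ε w b a := by
  apply Finset.card_le_card_of_injOn fun π => (Equiv.swap a w).trans π
  · intro π hπ
    simp only [Finset.coe_filter, Finset.mem_univ, true_and, Set.mem_ofPred_eq] at hπ ⊢
    exact hπ.swap_outer hsymm
  · intro π _ π' _ h
    ext x
    have := congrArg (fun σ : Equiv.Perm (Fin N) => σ (Equiv.swap a w x)) h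
    simpa using congrArg Fin.val this

lemma hitCount_swap_outer (hsymm : ∀ u v, adj u v = adj v u) (a b w : Fin N) :
    hitCount adj c ε a b w = hitCount adj c ε w b a :=
  (hitCount_le_swap_outer hsymm a b w).antisymm (hitCount_le_swap_outer hsymm w b a)

/-- For a fixed permutation, a pair is hit by at most one pivot. -/
lemma PivotHits.not_lt (hsymm : ∀ u v, adj u v = adj v u) {π : Equiv.Perm (Fin N)}
    {a b w w' : Fin N} (h : PivotHits adj c ε π a b w) (h' : PivotHits adj c ε π a b w') :
    ¬ π w < π w' := by
  intro hlt
  have hlt' : (π w : ℕ) < π w' := hlt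
  obtain ⟨hbad, -, -, hw⟩ := h
  have hnbr : adj w a = true ∨ adj w b = true := by
    have := hsymm a w
    have := hsymm b w
    unfold OrderedBad at hbad
    grind
  rcases hnbr with hn | hn
  · exact not_active_of_inPivCluster hlt' (by simpa using hw)
      (Or.inr (by simpa using hn)) h'.2.1
  · exact not_active_of_inPivCluster hlt' (by simpa using hw)
      (Or.inr (by simpa using hn)) h'.2.2.1

lemma sum_hitCount_le (hsymm : ∀ u v, adj u v = adj v u) (a b : Fin N) :
    ∑ w, hitCount adj c ε a b w ≤ N.factorial := by
  unfold hitCount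
  rw [← Finset.card_biUnion]
  · refine (Finset.card_le_univ _).trans_eq ?_
    rw [Fintype.card_perm, Fintype.card_fin]
  · intro w _ w' _ hne
    rw [Function.onFun, Finset.disjoint_left]
    intro π hw hv
    simp only [Finset.mem_filter, Finset.mem_univ, true_and] at hw hv
    exact hne (π.injective (le_antisymm (not_lt.1 (hv.not_lt hsymm hw))
      (not_lt.1 (hw.not_lt hsymm hv))))

/-- Every disagreement induced by a pivot cluster is charged to a bad triangle. -/
lemma two_mul_Cpivot_le (hsymm : ∀ u v, adj u v = adj v u) (π : Equiv.Perm (Fin N)) :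
    2 * Cpivot adj c ε π ≤
      (Finset.univ.filter fun t : Fin N × Fin N × Fin N =>
        PivotHits adj c ε π t.1 t.2.1 t.2.2).card := by
  let P : Fin N → Fin N → Prop := fun a b =>
    (adj a b = true ∧ ∃ k : Fin N, cutAt adj c ε π k a b) ∨
      (adj a b = false ∧ ∃ q : Fin N, seqStates adj c ε π N a = Status.clustered q ∧
        seqStates adj c ε π N b = Status.clustered q)
  have hP : ∀ a b, P a b → P b a := by
    rintro a b (⟨hadj, k, hk, ha, hb, hc⟩ | ⟨hadj, q, ha, hb⟩)
    · exact Or.inl ⟨hsymm a b ▸ hadj, k, hk, hb, ha, hc.symm⟩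
    · exact Or.inr ⟨hsymm a b ▸ hadj, q, hb, ha⟩
  have hcard : 2 * Cpivot adj c ε π =
      (Finset.univ.filter fun p : Fin N × Fin N => p.1 ≠ p.2 ∧ P p.1 p.2).card := by
    unfold Cpivot
    refine Eq.trans ?_ ((two_mul_card_filter_lt P hP).trans ?_) <;> congr!
  rw [hcard]
  refine le_trans (Finset.card_le_card ?_)
    (Finset.card_image_le (f := fun t : Fin N × Fin N × Fin N => (t.1, t.2.1)))
  rintro ⟨a, b⟩ hp
  simp only [Finset.mem_filter, Finset.mem_univ, true_and] at hp
  simp only [Finset.mem_image, Finset.mem_filter, Finset.mem_univ, true_and, Prod.exists,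
    Prod.mk.injEq]
  obtain ⟨hne, ⟨hadj, k, hk, ha, hb, hc⟩ | ⟨hadj, q, ha, hb⟩⟩ := hp
  · refine ⟨a, b, π.symm k, ⟨?_, by simpa using ha, by simpa using hb, by simpa using hk⟩,
      rfl, rfl⟩
    have := hsymm a b
    have := hsymm a (π.symm k)
    have := hsymm b (π.symm k)
    unfold inPivCluster at hc
    unfold OrderedBad
    grind
  · obtain ⟨hq, ha, ha'⟩ := active_of_clustered ha
    obtain ⟨-, hb, hb'⟩ := active_of_clustered hb
    refine ⟨a, b, q, ⟨?_, ha, hb, hq⟩, rfl, rfl⟩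
    have := hsymm a b
    have := hsymm a q
    have := hsymm b q
    unfold inPivCluster at ha' hb'
    unfold OrderedBad
    grind

lemma two_mul_sum_Cpivot_le (hsymm : ∀ u v, adj u v = adj v u) :
    2 * ∑ π, Cpivot adj c ε π ≤ ∑ a, ∑ b, ∑ w, hitCount adj c ε a b w := by
  have h : ∑ a, ∑ b, ∑ w, hitCount adj c ε a b w = ∑ π : Equiv.Perm (Fin N),
      (Finset.univ.filter fun t : Fin N × Fin N × Fin N =>
        PivotHits adj c ε π t.1 t.2.1 t.2.2).card := by
    simp only [hitCount, Finset.card_filter]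
    symm
    rw [Finset.sum_comm, Fintype.sum_prod_type]
    simp only [Fintype.sum_prod_type]
  rw [h, Finset.mul_sum]
  exact Finset.sum_le_sum fun π _ => two_mul_Cpivot_le hsymm π

/-- Every clustering disagrees with some pair of every bad triangle. -/
lemma OrderedBad.exists_disagrees {a b w : Fin N} (h : OrderedBad adj a b w)
    (f : Fin N → Fin N) :
    Disagrees adj f a b ∨ Disagrees adj f b w ∨ Disagrees adj f a w := by
  unfold OrderedBad at h
  unfold Disagrees
  grind

lemma sum_hitCount_le_cost (hsymm : ∀ u v, adj u v = adj v u) (f : Fin N → Fin N) :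
    ∑ a, ∑ b, ∑ w, hitCount adj c ε a b w ≤ 2 * (3 * cost adj f * N.factorial) := by
  let d : Fin N → Fin N → ℕ := fun a b => if a ≠ b ∧ Disagrees adj f a b then 1 else 0
  have hcost : 2 * cost adj f = ∑ a, ∑ b, d a b := by
    have hd : ∀ a b, Disagrees adj f a b → Disagrees adj f b a := by
      intro a b h
      have := hsymm a b
      unfold Disagrees at *
      grind
    have h := two_mul_card_filter_lt (Disagrees adj f) hd
    rw [Finset.card_filter (fun p : Fin N × Fin N => p.1 ≠ p.2 ∧ Disagrees adj f p.1 p.2),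
      Fintype.sum_prod_type] at h
    rw [← h]
    unfold cost Disagrees
    congr!
  have hpt : ∀ a b w, hitCount adj c ε a b w ≤ d a b * hitCount adj c ε a b w +
      d b w * hitCount adj c ε a b w + d a w * hitCount adj c ε a b w := by
    intro a b w
    by_cases hbad : OrderedBad adj a b w
    · have h1 : 1 ≤ d a b + d b w + d a w := by
        obtain ⟨hab, hbw, haw, -⟩ := id hbad
        rcases hbad.exists_disagrees f with h | h | h
        · have : d a b = 1 := if_pos ⟨hab, h⟩
          omega
        · have : d b w = 1 := if_pos ⟨hbw, h⟩
          omega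
        · have : d a w = 1 := if_pos ⟨haw, h⟩
          omega
      nlinarith
    · have : hitCount adj c ε a b w = 0 := by
        unfold hitCount
        rw [Finset.card_eq_zero, Finset.filter_eq_empty_iff]
        exact fun π _ h => hbad h.1
      omega
  have h1 : ∑ a, ∑ b, ∑ w, d a b * hitCount adj c ε a b w ≤
      2 * cost adj f * N.factorial := by
    rw [hcost]
    simp only [← Finset.mul_sum, Finset.sum_mul]
    exact Finset.sum_le_sum fun a _ => Finset.sum_le_sum fun b _ =>
      Nat.mul_le_mul_left _ (sum_hitCount_le hsymm a b)
  have h3 : ∑ a, ∑ b, ∑ w, d a w * hitCount adj c ε a b w =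
      ∑ a, ∑ b, ∑ w, d a b * hitCount adj c ε a b w := by
    refine Finset.sum_congr rfl fun a _ => ?_
    rw [Finset.sum_comm]
    refine Finset.sum_congr rfl fun b _ => Finset.sum_congr rfl fun w _ => ?_
    rw [hitCount_swap_left hsymm a w b, hitCount_swap_outer hsymm w a b,
      hitCount_swap_left hsymm b a w]
  have h2 : ∑ a, ∑ b, ∑ w, d b w * hitCount adj c ε a b w =
      ∑ a, ∑ b, ∑ w, d a w * hitCount adj c ε a b w := by
    rw [Finset.sum_comm]
    refine Finset.sum_congr rfl fun a _ => Finset.sum_congr rfl fun b _ =>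
      Finset.sum_congr rfl fun w _ => ?_
    rw [hitCount_swap_left hsymm b a w]
  calc ∑ a, ∑ b, ∑ w, hitCount adj c ε a b w
      ≤ ∑ a, ∑ b, ∑ w, (d a b * hitCount adj c ε a b w +
          d b w * hitCount adj c ε a b w + d a w * hitCount adj c ε a b w) :=
        Finset.sum_le_sum fun a _ => Finset.sum_le_sum fun b _ =>
          Finset.sum_le_sum fun w _ => hpt a b w
    _ ≤ 2 * (3 * cost adj f * N.factorial) := by
        simp only [Finset.sum_add_distrib]
        rw [h2, h3]
        linarith

end Charging

/-- Over a uniformly random permutation, the expected number of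
disagreements induced by the pivot clusters of sequential Truncated-Pivot is at most
`3·OPT`. -/
theorem expected_Cpivot_le_three_OPT (N : ℕ) (c ε : ℝ) (hc : 0 < c) (hε0 : 0 < ε)
    (hε1 : ε < 1) (adj : Fin N → Fin N → Bool)
    (hsymm : ∀ u v, adj u v = adj v u) (hirr : ∀ u, adj u u = false) :
    Ex N (fun π => (Cpivot adj c ε π : ℝ)) ≤ 3 * (OPT adj : ℝ) := by
  have : Nonempty (Fin N → Fin N) := ⟨id⟩
  obtain ⟨f, hf⟩ : ∃ f, cost adj f = OPT adj := Nat.sInf_mem (Set.range_nonempty (cost adj))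
  have hsum : ∑ π, Cpivot adj c ε π ≤ 3 * OPT adj * N.factorial := by
    have h := (two_mul_sum_Cpivot_le (c := c) (ε := ε) hsymm).trans
      (sum_hitCount_le_cost hsymm f)
    rw [hf] at h
    omega
  rw [Ex, div_le_iff₀ (by exact_mod_cast N.factorial_pos)]
  exact_mod_cast hsum


end TruncatedPivot
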